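/- arXiv:2601.14410 — 3 statements merged into one kernel-verified Lean document; each statement's English description precedes it below -/
import Mathlib

section
/- Let ψ_1, …, ψ_k be unit vectors in ℂ^2 (qubit states). The family {ψ_1, …, ψ_k} is antidistinguishable if and only if there exist strictly positive real coefficients t_1, …, t_k such that ∑_{i=1}^k t_i |ψ_i⟩⟨ψ_i| = I (the 2×2 identity matrix), where |ψ_i⟩⟨ψ_i| denotes the rank-one matrix with (a,b) entry ψ_i(a)·conj(ψ_i(b)). -/
namespace QSE

noncomputable section

open scoped ComplexOrder

/-- The standard Hermitian inner product `⟨ψ, φ⟩ = ∑ a, conj (ψ a) * φ a` on `I → ℂ`. -/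
def inp {I : Type} [Fintype I] (ψ φ : I → ℂ) : ℂ :=
  ∑ a, (starRingEnd ℂ) (ψ a) * φ a

/-- A family of pure states `ψ 1, …, ψ k` (vectors in a complex Euclidean space indexed by `I`)
is antidistinguishable if there is a POVM `P 1, …, P k` (positive semidefinite matrices summing
to the identity) such that `⟨ψ j, P j ψ j⟩ = 0` for every `j`, and for every `j` there is some
`i` with `⟨ψ i, P j ψ i⟩ ≠ 0`. -/
def Antidistinguishable {I : Type} [Fintype I] [DecidableEq I] {k : ℕ}
    (ψ : Fin k → I → ℂ) : Prop :=
  ∃ P : Fin k → Matrix I I ℂ,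
    (∀ j, (P j).PosSemidef) ∧ (∑ j, P j) = 1 ∧
    (∀ j, inp (ψ j) ((P j).mulVec (ψ j)) = 0) ∧
    (∀ j, ∃ i, inp (ψ i) ((P j).mulVec (ψ i)) ≠ 0)

/-- The concretely realized `N`-th tensor power of `ψ : Fin d → ℂ`: the vector indexed by
functions `f : Fin N → Fin d` whose component at `f` is `∏ t, ψ (f t)`. -/
def tpow {d : ℕ} (ψ : Fin d → ℂ) (N : ℕ) : (Fin N → Fin d) → ℂ :=
  fun f => ∏ t, ψ (f t)

/-- The family `ψ` is antidistinguishable with `N` copies if the family of `N`-th tensor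
powers is antidistinguishable. -/
def AntidistinguishableN {d k : ℕ} (ψ : Fin k → Fin d → ℂ) (N : ℕ) : Prop :=
  Antidistinguishable (fun i => tpow (ψ i) N)

/-- The family `ψ` is `N`-copy antidistinguishable if it is antidistinguishable with `N`
copies but not with any smaller positive number of copies. -/
def NCopyAntidistinguishable {d k : ℕ} (ψ : Fin k → Fin d → ℂ) (N : ℕ) : Prop :=
  AntidistinguishableN ψ N ∧
  ∀ N' : ℕ, 0 < N' → N' < N → ¬ AntidistinguishableN ψ N'


/-- The rank-one outer product `|ψ⟩⟨ψ|`, with `(a, b)` entry `ψ a * conj (ψ b)`. -/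
def outer {I : Type} (ψ : I → ℂ) : Matrix I I ℂ :=
  Matrix.of fun a b => ψ a * (starRingEnd ℂ) (ψ b)

lemma trace_outer {I : Type} [Fintype I] (ψ : I → ℂ) : (outer ψ).trace = inp ψ ψ := by
  simp [Matrix.trace, outer, inp, mul_comm]

lemma inp_mulVec_eq_trace {I : Type} [Fintype I] (Q : Matrix I I ℂ) (ψ : I → ℂ) :
    inp ψ (Q.mulVec ψ) = (Q * outer ψ).trace := by
  simp only [inp, Matrix.trace, Matrix.mulVec, dotProduct, Matrix.diag, Matrix.mul_apply, outer,
    Matrix.of_apply, Finset.mul_sum]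
  refine Finset.sum_congr rfl fun a _ => Finset.sum_congr rfl fun b _ => by ring

/-- The projection onto the orthogonal complement of a qubit state is positive semidefinite. -/
lemma posSemidef_one_sub_outer {ψ : Fin 2 → ℂ} (h : inp ψ ψ = 1) :
    (1 - outer ψ).PosSemidef := by
  have key : 1 - outer ψ = Matrix.vecMulVec ![star (ψ 1), -star (ψ 0)]
      (star ![star (ψ 1), -star (ψ 0)]) := by
    simp only [inp, Fin.sum_univ_two] at h
    ext a b
    fin_cases a <;> fin_cases b <;>
      simp [outer, Matrix.vecMulVec_apply] <;> grind
  rw [key]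
  exact Matrix.posSemidef_vecMulVec_self_star _

/-- A positive semidefinite `2 × 2` matrix whose quadratic form vanishes at a unit vector is a
multiple of the projection onto the orthogonal complement of that vector. -/
lemma eq_trace_smul_one_sub_outer {P : Matrix (Fin 2) (Fin 2) ℂ} (hP : P.PosSemidef)
    {ψ : Fin 2 → ℂ} (h : inp ψ ψ = 1) (h0 : inp ψ (P.mulVec ψ) = 0) :
    P = P.trace • (1 - outer ψ) := by
  have hv : P.mulVec ψ = 0 := (hP.dotProduct_mulVec_zero_iff ψ).1 h0
  have h1 : P 0 0 * ψ 0 + P 0 1 * ψ 1 = 0 := by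
    simpa [Matrix.mulVec, dotProduct] using congrFun hv 0
  have h2 : P 1 0 * ψ 0 + P 1 1 * ψ 1 = 0 := by
    simpa [Matrix.mulVec, dotProduct] using congrFun hv 1
  have h3 := congrArg star h1
  have h4 := congrArg star h2
  simp only [star_add, star_mul', hP.1.apply, star_zero, RCLike.star_def] at h3 h4
  simp only [inp, Fin.sum_univ_two] at h
  ext a b
  fin_cases a <;> fin_cases b <;>
    simp [outer, Matrix.trace]
  · linear_combination starRingEnd ℂ (ψ 0) * h1 - ψ 1 * h4 + P 1 1 * h
  · linear_combination (-P 0 1) * h + starRingEnd ℂ (ψ 1) * h1 + ψ 0 * h4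
  · linear_combination (-P 1 0) * h + ψ 1 * h3 + starRingEnd ℂ (ψ 0) * h2
  · linear_combination starRingEnd ℂ (ψ 1) * h2 - ψ 0 * h3 + P 0 0 * h

/-- For qubit states, weights resolving the identity for the states also do so for their
orthogonal complements, and conversely. -/
lemma sum_smul_one_sub_outer_eq_one_iff {k : ℕ} {ψ : Fin k → Fin 2 → ℂ}
    (hunit : ∀ i, inp (ψ i) (ψ i) = 1) (c : Fin k → ℂ) :
    ∑ i, c i • (1 - outer (ψ i)) = 1 ↔ ∑ i, c i • outer (ψ i) = 1 := by
  have hsub : ∑ i, c i • (1 - outer (ψ i)) =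
      (∑ i, c i) • (1 : Matrix (Fin 2) (Fin 2) ℂ) - ∑ i, c i • outer (ψ i) := by
    simp only [smul_sub, Finset.sum_sub_distrib, Finset.sum_smul]
  have htr : (∑ i, c i • outer (ψ i)).trace = ∑ i, c i := by
    simp [Matrix.trace_sum, trace_outer, hunit]
  rw [hsub]
  constructor <;> intro h
  · have h2 := congrArg Matrix.trace h
    rw [Matrix.trace_sub, htr, Matrix.trace_smul, Matrix.trace_one] at h2
    have hc : ∑ i, c i = 2 := by
      simp only [Fintype.card_fin, smul_eq_mul] at h2
      push_cast at h2
      linear_combination h2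
    rw [hc, two_smul, sub_eq_iff_eq_add] at h
    exact (add_left_cancel h).symm
  · have hc : ∑ i, c i = 2 := by
      rw [← htr, h, Matrix.trace_one]
      simp
    rw [hc, h, two_smul, add_sub_cancel_right]

/-- A family of qubit unit vectors is antidistinguishable iff there are strictly positive
reals `t i` with `∑ i, t i • |ψ i⟩⟨ψ i| = I`. -/
theorem stmt2 {k : ℕ} (ψ : Fin k → Fin 2 → ℂ)
    (hunit : ∀ i, inp (ψ i) (ψ i) = 1) :
    Antidistinguishable ψ ↔
      ∃ t : Fin k → ℝ, (∀ i, 0 < t i) ∧ ∑ i, (t i : ℂ) • outer (ψ i) = 1 := by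
  constructor
  · rintro ⟨P, hP, hsum, hzero, hne⟩
    have hform j := eq_trace_smul_one_sub_outer (hP j) (hunit j) (hzero j)
    have hre j : (((P j).trace.re : ℝ) : ℂ) = (P j).trace :=
      (Complex.eq_re_of_ofReal_le (r := 0) (by simpa using (hP j).trace_nonneg)).symm
    refine ⟨fun j => (P j).trace.re, fun j => ?_, ?_⟩
    · refine lt_of_le_of_ne (Complex.le_def.1 (hP j).trace_nonneg).1 fun h => ?_
      have htr : (P j).trace = 0 := by
        rw [← hre j]
        exact_mod_cast h.symm
      obtain ⟨i, hi⟩ := hne j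
      apply hi
      rw [inp_mulVec_eq_trace, hform j, htr]
      simp
    · simp only [hre]
      rw [← sum_smul_one_sub_outer_eq_one_iff hunit]
      exact (Finset.sum_congr rfl fun j _ => (hform j).symm).trans hsum
  · rintro ⟨t, ht, hsum⟩
    refine ⟨fun j => (t j : ℂ) • (1 - outer (ψ j)), fun j => ?_, ?_, fun j => ?_, fun j => ?_⟩
    · exact (posSemidef_one_sub_outer (hunit j)).smul (by exact_mod_cast (ht j).le)
    · exact (sum_smul_one_sub_outer_eq_one_iff hunit _).2 hsum
    · have h : (outer (ψ j)).mulVec (ψ j) = ψ j := by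
        ext a
        have h := hunit j
        simp only [inp, Fin.sum_univ_two] at h
        simp only [Matrix.mulVec, dotProduct, outer, Matrix.of_apply, Fin.sum_univ_two]
        linear_combination ψ j a * h
      simp [Matrix.smul_mulVec, Matrix.sub_mulVec, h, inp]
    · by_contra! hall
      have h := congrArg (fun M => (((t j : ℂ) • (1 - outer (ψ j))) * M).trace) hsum
      simp only [Matrix.mul_sum, Matrix.trace_sum, Matrix.mul_smul, Matrix.trace_smul,
        ← inp_mulVec_eq_trace, hall, smul_zero, Finset.sum_const_zero, mul_one,
        Matrix.trace_sub, Matrix.trace_one, trace_outer, hunit] at h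
      norm_num at h
      exact (ht j).ne (by exact_mod_cast h)

end

end QSE
end

section
/- Let k ≥ 2 and let ψ_1, …, ψ_k be unit vectors in ℂ^d whose pairwise inner products are all equal to a real number γ with 0 ≤ γ < 1, i.e., ⟨ψ_i, ψ_j⟩ = γ for all i ≠ j. Then the family {ψ_1, …, ψ_k} is antidistinguishable if and only if γ ≤ (k−2)/(k−1). -/
namespace QSE

noncomputable section

open scoped ComplexOrder

open scoped MatrixOrder in
/-- A positive semidefinite matrix with a vanishing `j`-th diagonal entry is supported on the
remaining coordinates, so that Cauchy-Schwarz bounds the sum of its entries by `card - 1` times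
its trace. -/
lemma re_sum_entries_le_of_posSemidef {ι : Type} [Fintype ι] [DecidableEq ι]
    {M : Matrix ι ι ℂ} (hM : M.PosSemidef) {j : ι} (hj : M j j = 0) :
    (∑ i, ∑ l, M i l).re ≤ ((Fintype.card ι : ℝ) - 1) * (∑ i, M i i).re := by
  obtain ⟨C, hC⟩ := CStarAlgebra.nonneg_iff_eq_star_mul_self.mp hM.nonneg
  rw [Matrix.star_eq_conjTranspose] at hC
  subst hC
  have hdiag (i : ι) : (C.conjTranspose * C) i i = ((∑ a, ‖C a i‖ ^ 2 : ℝ) : ℂ) := by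
    simp [Matrix.mul_apply, Complex.conj_mul']
  have hcol (a : ι) : C a j = 0 := by
    rw [hdiag, Complex.ofReal_eq_zero,
      Finset.sum_eq_zero_iff_of_nonneg fun a _ => sq_nonneg _] at hj
    simpa using hj a
  have hsum : ∑ i, ∑ l, (C.conjTranspose * C) i l = ((∑ a, ‖∑ i, C a i‖ ^ 2 : ℝ) : ℂ) := by
    push_cast
    simp_rw [← Complex.conj_mul', map_sum, Finset.sum_mul_sum, Matrix.mul_apply,
      Matrix.conjTranspose_apply]
    calc ∑ i, ∑ l, ∑ a, star (C a i) * C a l = ∑ i, ∑ a, ∑ l, star (C a i) * C a l :=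
          Finset.sum_congr rfl fun _ _ => Finset.sum_comm
      _ = ∑ a, ∑ i, ∑ l, star (C a i) * C a l := Finset.sum_comm
  rw [hsum, Finset.sum_congr rfl fun i _ => hdiag i, ← Complex.ofReal_sum, Complex.ofReal_re,
    Complex.ofReal_re, Finset.sum_comm, Finset.mul_sum]
  refine Finset.sum_le_sum fun a _ => ?_
  have hcard : (((Finset.univ.erase j).card : ℕ) : ℝ) = (Fintype.card ι : ℝ) - 1 := by
    rw [Finset.card_erase_of_mem (Finset.mem_univ j), Finset.card_univ,
      Nat.cast_sub (Fintype.card_pos_iff.mpr ⟨j⟩), Nat.cast_one]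
  calc ‖∑ i, C a i‖ ^ 2
      = ‖∑ i ∈ Finset.univ.erase j, C a i‖ ^ 2 := by
        rw [Finset.sum_erase _ (hcol a)]
    _ ≤ (∑ i ∈ Finset.univ.erase j, ‖C a i‖) ^ 2 := by
        gcongr
        exact norm_sum_le _ _
    _ ≤ (Finset.univ.erase j).card * ∑ i ∈ Finset.univ.erase j, ‖C a i‖ ^ 2 :=
        sq_sum_le_card_mul_sum_sq
    _ = ((Fintype.card ι : ℝ) - 1) * ∑ i, ‖C a i‖ ^ 2 := by
        rw [hcard, Finset.sum_erase _ (by simp [hcol a])]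

/-- The Gram matrix with unit diagonal and constant off-diagonal entry `γ`. -/
def equiGram (k : ℕ) (γ : ℝ) : Matrix (Fin k) (Fin k) ℂ :=
  fun i l => if i = l then 1 else (γ : ℂ)

lemma posSemidef_diagonal_add_vecMulVec {k : ℕ} {a b : ℝ} (ha : 0 ≤ a) (hb : 0 ≤ b)
    (v : Fin k → ℝ) (hv : ∀ i, 0 ≤ v i) :
    (Matrix.diagonal (fun i => ((a * v i : ℝ) : ℂ)) +
      (b : ℂ) • Matrix.vecMulVec (fun i => (v i : ℂ)) (star fun i => (v i : ℂ))).PosSemidef := by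
  refine Matrix.PosSemidef.add (Matrix.PosSemidef.diagonal fun i => ?_)
    ((Matrix.posSemidef_vecMulVec_self_star _).smul ?_)
  · exact Complex.zero_le_real.mpr (mul_nonneg ha (hv i))
  · exact_mod_cast hb

lemma posDef_equiGram {k : ℕ} {γ : ℝ} (hγ0 : 0 ≤ γ) (hγ1 : γ < 1) :
    (equiGram k γ).PosDef := by
  have h : equiGram k γ = Matrix.diagonal (fun _ => ((1 - γ : ℝ) : ℂ)) +
      (γ : ℂ) • Matrix.vecMulVec (fun _ => 1) (star fun _ => 1) := by
    ext i l
    by_cases hil : i = l <;> simp [equiGram, hil, Matrix.vecMulVec_apply]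
  rw [h]
  refine Matrix.PosDef.add_posSemidef (Matrix.PosDef.diagonal fun _ => ?_)
    ((Matrix.posSemidef_vecMulVec_self_star _).smul ?_)
  · exact_mod_cast sub_pos.mpr hγ1
  · exact_mod_cast hγ0

/-- A decomposition of an equiangular Gram matrix into positive semidefinite matrices, the `j`-th
of which has vanishing `j`-th diagonal entry. -/
lemma exists_equiGram_decomposition {k : ℕ} (hk : 2 ≤ k) {γ : ℝ} (hγ0 : 0 ≤ γ)
    (hγ : γ ≤ ((k : ℝ) - 2) / ((k : ℝ) - 1)) :
    ∃ N : Fin k → Matrix (Fin k) (Fin k) ℂ, (∀ j, (N j).PosSemidef) ∧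
      ∑ j, N j = equiGram k γ ∧ (∀ j, N j j j = 0) ∧ ∀ j, ∃ i, N j i i ≠ 0 := by
  have hk' : (2 : ℝ) ≤ k := by exact_mod_cast hk
  have hk1 : (0 : ℝ) < (k : ℝ) - 1 := by linarith
  obtain ⟨b, hb0, hbγ, hba⟩ : ∃ b : ℝ, 0 ≤ b ∧ ((k : ℝ) - 2) * b = γ ∧ b ≤ 1 / ((k : ℝ) - 1) := by
    rcases hk'.eq_or_lt with h | h
    · refine ⟨0, le_rfl, ?_, by positivity⟩
      rw [← h] at hγ
      norm_num at hγ
      linarith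
    · have h2 : (0 : ℝ) < (k : ℝ) - 2 := by linarith
      refine ⟨γ / ((k : ℝ) - 2), by positivity, by field_simp, ?_⟩
      rw [div_le_iff₀ h2]
      calc γ ≤ _ := hγ
        _ = _ := by ring
  let v : Fin k → Fin k → ℝ := fun j i => if i = j then 0 else 1
  refine ⟨fun j => _, fun j => posSemidef_diagonal_add_vecMulVec (sub_nonneg.mpr hba) hb0 (v j)
    fun i => ?_, ?_, fun j => ?_, fun j => ?_⟩
  · dsimp only [v]
    split_ifs <;> norm_num
  · have hone (i : Fin k) : ∑ j, v j i = (k : ℝ) - 1 := by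
      have h (j : Fin k) : v j i = 1 - if i = j then 1 else 0 := by
        dsimp only [v]; split_ifs <;> norm_num
      simp [h, Finset.sum_sub_distrib]
    have htwo (i l : Fin k) (hil : i ≠ l) : ∑ j, v j i * v j l = (k : ℝ) - 2 := by
      have h (j : Fin k) : v j i * v j l =
          1 - (if i = j then 1 else 0) - if l = j then 1 else 0 := by
        dsimp only [v]; split_ifs <;> simp_all
      simp only [h, Finset.sum_sub_distrib, Finset.sum_ite_eq]
      simp
      ring
    have hsq (j i : Fin k) : v j i * v j i = v j i := by
      dsimp only [v]; split_ifs <;> norm_num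
    ext i l
    by_cases hil : i = l
    · subst hil
      have h : ∑ j, ((1 / ((k : ℝ) - 1) - b) * v j i + b * (v j i * v j i)) = 1 := by
        simp_rw [hsq, Finset.sum_add_distrib, ← Finset.mul_sum, hone]
        field_simp
        ring
      simpa [Matrix.sum_apply, Matrix.vecMulVec_apply, equiGram] using congrArg Complex.ofReal h
    · have h : ∑ j, b * (v j i * v j l) = γ := by
        rw [← Finset.mul_sum, htwo i l hil, mul_comm, hbγ]
      simpa [Matrix.sum_apply, Matrix.vecMulVec_apply, equiGram, hil] using
        congrArg Complex.ofReal h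
  · simp [v, Matrix.vecMulVec_apply]
  · have : Nontrivial (Fin k) := Fin.nontrivial_iff_two_le.mpr hk
    obtain ⟨i, hi⟩ := exists_ne j
    refine ⟨i, ?_⟩
    have : (k : ℂ) - 1 ≠ 0 := by exact_mod_cast hk1.ne'
    simp [v, hi, Matrix.vecMulVec_apply, this]

/-- The matrix whose columns are the vectors `ψ i`. -/
def columns {d k : ℕ} (ψ : Fin k → Fin d → ℂ) : Matrix (Fin d) (Fin k) ℂ :=
  fun a i => ψ i a

lemma conjTranspose_columns_mul_mul_apply {d k : ℕ} (ψ : Fin k → Fin d → ℂ)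
    (P : Matrix (Fin d) (Fin d) ℂ) (i l : Fin k) :
    ((columns ψ).conjTranspose * P * columns ψ) i l = inp (ψ i) (P.mulVec (ψ l)) := by
  rw [Matrix.mul_assoc]
  rfl

lemma antidistinguishable_of_decomposition {d k : ℕ} (hk : 0 < k) (ψ : Fin k → Fin d → ℂ)
    {G : Matrix (Fin k) (Fin k) ℂ} (hψ : (columns ψ).conjTranspose * columns ψ = G)
    (hG : G.PosDef) (N : Fin k → Matrix (Fin k) (Fin k) ℂ) (hN : ∀ j, (N j).PosSemidef)
    (hsum : ∑ j, N j = G) (hzero : ∀ j, N j j j = 0) (hne : ∀ j, ∃ i, N j i i ≠ 0) :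
    Antidistinguishable ψ := by
  set A := columns ψ
  have hGl : G⁻¹ * G = 1 := Matrix.nonsing_inv_mul G ((Matrix.isUnit_iff_isUnit_det _).mp hG.isUnit)
  have hGr : G * G⁻¹ = 1 := Matrix.mul_nonsing_inv G ((Matrix.isUnit_iff_isUnit_det _).mp hG.isUnit)
  have hGh : (G⁻¹).conjTranspose = G⁻¹ := hG.isHermitian.inv
  set B := A * G⁻¹ with hB
  have hBh : B.conjTranspose = G⁻¹ * A.conjTranspose := by
    rw [hB, Matrix.conjTranspose_mul, hGh]
  have hBA : B.conjTranspose * A = 1 := by rw [hBh, Matrix.mul_assoc, hψ, hGl]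
  have hAB : A.conjTranspose * B = 1 := by rw [hB, ← Matrix.mul_assoc, hψ, hGr]
  have hBGB : B * G * B.conjTranspose = A * B.conjTranspose := by
    rw [hB, Matrix.mul_assoc A, hGl, Matrix.mul_one]
  set Q := 1 - A * B.conjTranspose with hQ
  have hQA : Q * A = 0 := by
    rw [hQ, Matrix.sub_mul, Matrix.mul_assoc, hBA, Matrix.one_mul, Matrix.mul_one, sub_self]
  have hQh : Q.conjTranspose = Q := by
    rw [hQ, hBh, ← Matrix.mul_assoc]
    simp [Matrix.conjTranspose_mul, hGh, Matrix.mul_assoc]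
  have hQQ : Q.conjTranspose * Q = Q := by
    rw [hQh]
    nth_rewrite 2 [hQ]
    rw [Matrix.mul_sub, ← Matrix.mul_assoc, hQA, Matrix.zero_mul, Matrix.mul_one, sub_zero]
  have hQpsd : Q.PosSemidef := hQQ ▸ Matrix.posSemidef_conjTranspose_mul_self Q
  have hentry (j i : Fin k) :
      inp (ψ i) ((B * N j * B.conjTranspose + (k : ℂ)⁻¹ • Q).mulVec (ψ i)) = N j i i := by
    rw [← conjTranspose_columns_mul_mul_apply]
    have : A.conjTranspose * (B * N j * B.conjTranspose + (k : ℂ)⁻¹ • Q) * A = N j := by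
      rw [Matrix.mul_assoc, Matrix.add_mul, Matrix.smul_mul, hQA, smul_zero, add_zero,
        Matrix.mul_assoc, hBA, Matrix.mul_one, ← Matrix.mul_assoc, hAB, Matrix.one_mul]
    exact congrFun (congrFun this i) i
  refine ⟨fun j => B * N j * B.conjTranspose + (k : ℂ)⁻¹ • Q, fun j => ?_, ?_, fun j => ?_,
    fun j => ?_⟩
  · refine ((hN j).mul_mul_conjTranspose_same B).add (hQpsd.smul ?_)
    positivity
  · rw [Finset.sum_add_distrib, ← Matrix.sum_mul, ← Matrix.mul_sum, hsum, hBGB]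
    have hk0 : (k : ℂ) ≠ 0 := by exact_mod_cast hk.ne'
    simp [← Nat.cast_smul_eq_nsmul ℂ, smul_smul, hk0, hQ]
  · rw [hentry, hzero]
  · obtain ⟨i, hi⟩ := hne j
    exact ⟨i, by rwa [hentry]⟩

/-- A family of `k ≥ 2` unit vectors with equal real pairwise inner products `γ ∈ [0, 1)`
is antidistinguishable iff `γ ≤ (k-2)/(k-1)`. -/
theorem stmt6 {d k : ℕ} (hk : 2 ≤ k) (ψ : Fin k → Fin d → ℂ)
    (hunit : ∀ i, inp (ψ i) (ψ i) = 1)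
    (γ : ℝ) (hγ0 : 0 ≤ γ) (hγ1 : γ < 1)
    (hinner : ∀ i j, i ≠ j → inp (ψ i) (ψ j) = (γ : ℂ)) :
    Antidistinguishable ψ ↔ γ ≤ ((k : ℝ) - 2) / ((k : ℝ) - 1) := by
  have hgram : (columns ψ).conjTranspose * columns ψ = equiGram k γ := by
    ext i l
    change inp (ψ i) (ψ l) = _
    by_cases hil : i = l
    · rw [hil, hunit, equiGram, if_pos rfl]
    · rw [hinner i l hil, equiGram, if_neg hil]
  constructor
  · rintro ⟨P, hP, hsum, hzero, -⟩
    set A := columns ψ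
    have hle (j : Fin k) := re_sum_entries_le_of_posSemidef
      ((hP j).conjTranspose_mul_mul_same A) (j := j)
      ((conjTranspose_columns_mul_mul_apply ψ (P j) j j).trans (hzero j))
    have hG : ∑ j, A.conjTranspose * P j * A = equiGram k γ := by
      rw [← Matrix.sum_mul, ← Matrix.mul_sum, hsum, Matrix.mul_one, hgram]
    have hG' (i l : Fin k) : ∑ j, (A.conjTranspose * P j * A) i l = equiGram k γ i l := by
      rw [← hG, Matrix.sum_apply]
    have htot := Finset.sum_le_sum fun j (_ : j ∈ Finset.univ) => hle j
    rw [← Finset.mul_sum, ← Complex.re_sum, ← Complex.re_sum, Finset.sum_comm,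
      Finset.sum_comm (f := fun j i => (A.conjTranspose * P j * A) i i)] at htot
    simp_rw [hG'] at htot
    have hrow : ∀ i, ∑ j, ∑ l, (A.conjTranspose * P j * A) i l
        = ((1 + ((k : ℝ) - 1) * γ : ℝ) : ℂ) := by
      intro i
      rw [Finset.sum_comm]
      simp_rw [hG']
      have h (l : Fin k) : equiGram k γ i l = γ + if i = l then (1 - γ : ℂ) else 0 := by
        rw [equiGram]; split_ifs <;> simp
      simp [h, Finset.sum_add_distrib]
      ring
    simp_rw [hrow] at htot
    have hk' : (2 : ℝ) ≤ k := by exact_mod_cast hk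
    rw [le_div_iff₀ (by linarith)]
    simp [equiGram] at htot
    have h := le_of_mul_le_mul_left (a := (k : ℝ))
      (by linarith : (k : ℝ) * (1 + (k - 1) * γ) ≤ k * (k - 1))
      (by linarith)
    linarith
  · intro hγ
    obtain ⟨N, hN, hsum, hzero, hne⟩ := exists_equiGram_decomposition hk hγ0 hγ
    exact antidistinguishable_of_decomposition (by lia) ψ hgram (posDef_equiGram hγ0 hγ1) N hN hsum
      hzero hne

end

end QSE
end

section
/- Let k ≥ 3 and let ψ_1, …, ψ_k be unit vectors in ℂ^d whose pairwise inner products are all equal to a real number γ with (k−2)/(k−1) < γ < 1, i.e., ⟨ψ_i, ψ_j⟩ = γ for all i ≠ j. Then the family {ψ_1, …, ψ_k} is N-copy antidistinguishable for N = ⌈ ln((k−2)/(k−1)) / ln γ ⌉. -/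
namespace QSE

noncomputable section

open scoped ComplexOrder

lemma inp_tpow {d : ℕ} (ψ φ : Fin d → ℂ) (N : ℕ) :
    inp (tpow ψ N) (tpow φ N) = inp ψ φ ^ N := by
  simp only [inp, tpow, Fintype.sum_pow, map_prod, Finset.prod_mul_distrib]

open Matrix in
/-- Compressing an operator to the family `φ` gives its matrix elements. -/
lemma conjTranspose_mul_mul_apply {I : Type} [Fintype I] {k : ℕ} (φ : Fin k → I → ℂ)
    (P : Matrix I I ℂ) (i l : Fin k) :
    ((of φ)ᵀᴴ * P * (of φ)ᵀ) i l = inp (φ i) (P *ᵥ φ l) := by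
  rw [Matrix.mul_assoc]
  simp [Matrix.mul_apply, inp, Matrix.mulVec, dotProduct]

open Matrix in
lemma conjTranspose_mul_apply {I : Type} [Fintype I] {k : ℕ} (φ : Fin k → I → ℂ)
    (i l : Fin k) : ((of φ)ᵀᴴ * (of φ)ᵀ) i l = inp (φ i) (φ l) := by
  simp [Matrix.mul_apply, inp]

open Matrix in
/-- A positive semidefinite matrix with a vanishing diagonal entry has the sum of its entries
bounded by `k - 1` times its trace. -/
lemma sum_le_trace_of_diag_eq_zero {k : ℕ} {M : Matrix (Fin k) (Fin k) ℂ} (hM : M.PosSemidef)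
    {j : Fin k} (hj : M j j = 0) :
    ∑ i, ∑ l, M i l ≤ ((k : ℂ) - 1) * M.trace := by
  have hcol : ∀ i, M i j = 0 := by
    have h := (hM.dotProduct_mulVec_zero_iff (Pi.single j 1)).1 (by simp [hj])
    intro i
    simpa using congrFun h i
  have hrow : ∀ l, M j l = 0 := by
    intro l
    rw [← hM.isHermitian.apply j l, hcol l, star_zero]
  have hcard : ((Finset.univ.erase j).card : ℂ) = (k : ℂ) - 1 := by
    rw [Finset.card_erase_of_mem (Finset.mem_univ j), Finset.card_univ, Fintype.card_fin,
      Nat.cast_sub (by have := j.2; omega), Nat.cast_one]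
  have hS : ∑ i, ∑ l, M i l = ∑ i ∈ Finset.univ.erase j, ∑ l ∈ Finset.univ.erase j, M i l := by
    rw [← Finset.sum_erase (a := j) _ (by simp [hrow])]
    exact Finset.sum_congr rfl fun i _ => (Finset.sum_erase _ (hcol i)).symm
  have hT : M.trace = ∑ i ∈ Finset.univ.erase j, M i i :=
    (Finset.sum_erase (f := fun i => M i i) _ hj).symm
  have hpair : ∀ i l, 0 ≤ M i i + M l l - M i l - M l i := by
    intro i l
    have h := hM.dotProduct_mulVec_nonneg (Pi.single i 1 - Pi.single l 1)
    simp only [star_sub, Pi.star_single, star_one, Matrix.mulVec_sub, sub_dotProduct,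
      dotProduct_sub, Matrix.mulVec_single_one, single_dotProduct, one_mul, Matrix.col_apply] at h
    convert h using 1
    ring
  have hnn := Finset.sum_nonneg fun i (_ : i ∈ Finset.univ.erase j) =>
    Finset.sum_nonneg fun l (_ : l ∈ Finset.univ.erase j) => hpair i l
  simp only [Finset.sum_sub_distrib, Finset.sum_add_distrib, Finset.sum_const, nsmul_eq_mul,
    ← Finset.mul_sum] at hnn
  rw [Finset.sum_comm (f := fun i l => M l i), hcard, ← hS, ← hT] at hnn
  rw [← sub_nonneg]
  have h2 : (0 : ℂ) ≤ 1 / 2 := one_div_nonneg.2 zero_le_two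
  convert mul_nonneg h2 hnn using 1
  ring

open Matrix in
/-- Equiangular unit vectors that are antidistinguishable have inner product at most
`(k - 2) / (k - 1)`. -/
lemma Antidistinguishable.inner_le {I : Type} [Fintype I] [DecidableEq I] {k : ℕ} (hk : 3 ≤ k)
    {φ : Fin k → I → ℂ} {g : ℝ} (hunit : ∀ i, inp (φ i) (φ i) = 1)
    (hinner : ∀ i j, i ≠ j → inp (φ i) (φ j) = (g : ℂ)) (h : Antidistinguishable φ) :
    g ≤ ((k : ℝ) - 2) / ((k : ℝ) - 1) := by
  obtain ⟨P, hP, hsum, hzero, -⟩ := h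
  have hk' : (3 : ℝ) ≤ k := by exact_mod_cast hk
  set M : Fin k → Matrix (Fin k) (Fin k) ℂ := fun j => (of φ)ᵀᴴ * P j * (of φ)ᵀ with hM
  have hMpsd : ∀ j, (M j).PosSemidef := fun j => (hP j).conjTranspose_mul_mul_same _
  have hle := Finset.sum_le_sum fun j (_ : j ∈ Finset.univ) =>
    sum_le_trace_of_diag_eq_zero (hMpsd j) (j := j)
      (by rw [hM]; simp only; rw [conjTranspose_mul_mul_apply]; exact hzero j)
  have hG : ∀ i l, ∑ j, M j i l = if i = l then 1 else (g : ℂ) := by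
    intro i l
    rw [← Matrix.sum_apply, hM]
    simp only [← Matrix.sum_mul, ← Matrix.mul_sum]
    rw [hsum, Matrix.mul_one, conjTranspose_mul_apply]
    split_ifs with hil
    · rw [hil, hunit]
    · exact hinner i l hil
  have hL : ∑ j, ∑ i, ∑ l, M j i l = (k : ℂ) * (1 + ((k : ℂ) - 1) * g) := by
    rw [Finset.sum_comm]
    have : ∀ i, ∑ j, ∑ l, M j i l = 1 + ((k : ℂ) - 1) * g := by
      intro i
      rw [Finset.sum_comm]
      simp only [hG]
      rw [← Finset.add_sum_erase _ _ (Finset.mem_univ i), if_pos rfl]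
      rw [Finset.sum_congr rfl fun l hl => if_neg (Finset.ne_of_mem_erase hl).symm]
      rw [Finset.sum_const, Finset.card_erase_of_mem (Finset.mem_univ i), Finset.card_univ,
        Fintype.card_fin, nsmul_eq_mul, Nat.cast_sub (by omega), Nat.cast_one]
    simp only [this, Finset.sum_const, Finset.card_univ, Fintype.card_fin, nsmul_eq_mul]
  have hR : ∑ j, ((k : ℂ) - 1) * (M j).trace = ((k : ℂ) - 1) * k := by
    rw [← Finset.mul_sum]
    simp only [Matrix.trace, Matrix.diag]
    rw [Finset.sum_comm]
    simp [hG]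
  rw [hL, hR] at hle
  have hle' : (k : ℝ) * (1 + ((k : ℝ) - 1) * g) ≤ ((k : ℝ) - 1) * k := by exact_mod_cast hle
  rw [le_div_iff₀ (by linarith)]
  nlinarith

open Matrix in
/-- If the Gram matrix `G` of `φ` is invertible and splits into positive semidefinite parts
`H j` with `H j j j = 0` and not all diagonal entries of `H j` zero, then `φ` is
antidistinguishable. -/
lemma antidistinguishable_of_gram {I : Type} [Fintype I] [DecidableEq I] {k : ℕ} (hk : k ≠ 0)
    {φ : Fin k → I → ℂ} {G : Matrix (Fin k) (Fin k) ℂ} (hG : (of φ)ᵀᴴ * (of φ)ᵀ = G)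
    (hunit : IsUnit G) {H : Fin k → Matrix (Fin k) (Fin k) ℂ} (hH : ∀ j, (H j).PosSemidef)
    (hsum : ∑ j, H j = G) (hzero : ∀ j, H j j j = 0) (hne : ∀ j, ∃ i, H j i i ≠ 0) :
    Antidistinguishable φ := by
  have hdet : IsUnit G.det := (Matrix.isUnit_iff_isUnit_det G).1 hunit
  set Φ : Matrix I (Fin k) ℂ := (of φ)ᵀ with hΦ
  have hGH : Gᴴ = G := by rw [← hG]; simp
  set E : Matrix I (Fin k) ℂ := Φ * G⁻¹ with hE
  have hEH : Eᴴ = G⁻¹ * Φᴴ := by rw [hE, conjTranspose_mul, conjTranspose_nonsing_inv, hGH]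
  have h1 : Φᴴ * E = 1 := by rw [hE, ← Matrix.mul_assoc, hG, mul_nonsing_inv _ hdet]
  have h2 : Eᴴ * Φ = 1 := by rw [hEH, Matrix.mul_assoc, hG, nonsing_inv_mul _ hdet]
  have hproj : E * G * Eᴴ = E * Φᴴ := by
    rw [hEH, Matrix.mul_assoc E, ← Matrix.mul_assoc G, mul_nonsing_inv _ hdet, Matrix.one_mul]
  have hQH : (1 - E * Φᴴ)ᴴ = 1 - E * Φᴴ := by
    rw [conjTranspose_sub, conjTranspose_one, conjTranspose_mul, conjTranspose_conjTranspose, hEH,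
      hE, Matrix.mul_assoc]
  have hQ : (1 - E * Φᴴ).PosSemidef := by
    have h := posSemidef_conjTranspose_mul_self (1 - E * Φᴴ)
    have hidem : E * Φᴴ * (E * Φᴴ) = E * Φᴴ := by
      rw [Matrix.mul_assoc, ← Matrix.mul_assoc Φᴴ, h1, Matrix.one_mul]
    rwa [hQH, Matrix.mul_sub, Matrix.mul_one, Matrix.sub_mul, Matrix.one_mul, hidem,
      sub_self, sub_zero] at h
  set P : Fin k → Matrix I I ℂ := fun j => E * H j * Eᴴ + ((k : ℂ)⁻¹) • (1 - E * Φᴴ) with hP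
  have hkey : ∀ i j, inp (φ i) (P j *ᵥ φ i) = H j i i := by
    intro i j
    have hc : Φᴴ * (E * H j * Eᴴ) * Φ = H j := by
      rw [Matrix.mul_assoc, Matrix.mul_assoc, h2, Matrix.mul_one, ← Matrix.mul_assoc, h1,
        Matrix.one_mul]
    have hq : Φᴴ * (1 - E * Φᴴ) = 0 := by
      rw [Matrix.mul_sub, Matrix.mul_one, ← Matrix.mul_assoc, h1, Matrix.one_mul, sub_self]
    rw [← conjTranspose_mul_mul_apply, ← hΦ, hP]
    simp only
    rw [Matrix.mul_add, Matrix.add_mul, hc, Matrix.mul_smul, hq, smul_zero, Matrix.zero_mul,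
      add_zero]
  refine ⟨P, fun j => ?_, ?_, fun j => ?_, fun j => ?_⟩
  · refine ((hH j).mul_mul_conjTranspose_same E).add (hQ.smul ?_)
    rw [inv_nonneg]
    exact_mod_cast Nat.zero_le k
  · rw [hP, Finset.sum_add_distrib, ← Matrix.sum_mul, ← Matrix.mul_sum, hsum, hproj,
      Finset.sum_const, Finset.card_univ, Fintype.card_fin, ← Nat.cast_smul_eq_nsmul ℂ, smul_smul,
      mul_inv_cancel₀ (by exact_mod_cast hk), one_smul, add_sub_cancel]
  · rw [hkey, hzero]
  · obtain ⟨i, hi⟩ := hne j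
    exact ⟨i, by rwa [hkey]⟩

open Matrix in
/-- Equiangular unit vectors with positive inner product at most `(k - 2) / (k - 1)` are
antidistinguishable. -/
lemma antidistinguishable_of_inner_le {I : Type} [Fintype I] [DecidableEq I] {k : ℕ} (hk : 3 ≤ k)
    {φ : Fin k → I → ℂ} {g : ℝ} (hunit : ∀ i, inp (φ i) (φ i) = 1)
    (hinner : ∀ i j, i ≠ j → inp (φ i) (φ j) = (g : ℂ)) (hg0 : 0 ≤ g)
    (hg : g ≤ ((k : ℝ) - 2) / ((k : ℝ) - 1)) : Antidistinguishable φ := by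
  have hk' : (3 : ℝ) ≤ k := by exact_mod_cast hk
  have hk1 : (k : ℂ) - 1 ≠ 0 := by
    exact_mod_cast (by linarith : (k : ℝ) - 1 ≠ 0)
  have hk2 : (k : ℂ) - 2 ≠ 0 := by
    exact_mod_cast (by linarith : (k : ℝ) - 2 ≠ 0)
  set b : ℝ := g / ((k : ℝ) - 2) with hb
  set a : ℝ := 1 / ((k : ℝ) - 1) - b with ha
  have hb0 : 0 ≤ b := div_nonneg hg0 (by linarith)
  have ha0 : 0 ≤ a := by
    rw [ha, hb, sub_nonneg, div_le_div_iff₀ (by linarith) (by linarith)]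
    rw [le_div_iff₀ (by linarith)] at hg
    linarith
  have hg1 : g < 1 := by
    refine hg.trans_lt ?_
    rw [div_lt_one (by linarith)]
    linarith
  set u : Fin k → Fin k → ℂ := fun j i => if i = j then 0 else 1 with hu
  set H : Fin k → Matrix (Fin k) (Fin k) ℂ := fun j =>
    (a : ℂ) • diagonal (u j) + (b : ℂ) • vecMulVec (u j) (star (u j)) with hH
  set G : Matrix (Fin k) (Fin k) ℂ := (of φ)ᵀᴴ * (of φ)ᵀ with hG
  have hGa : ∀ i l, G i l = if i = l then 1 else (g : ℂ) := by
    intro i l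
    rw [hG, conjTranspose_mul_apply]
    split_ifs with hil
    · rw [hil, hunit]
    · exact hinner i l hil
  have hGeq : G = ((1 - g : ℝ) : ℂ) • (1 : Matrix (Fin k) (Fin k) ℂ) +
      (g : ℂ) • vecMulVec (fun _ => 1) (star fun _ => 1) := by
    ext i l
    rw [hGa]
    by_cases hil : i = l <;> simp [vecMulVec_apply, hil]
  have hGpos : G.PosDef := by
    rw [hGeq]
    refine (PosDef.one.smul ?_).add_posSemidef ((posSemidef_vecMulVec_self_star _).smul ?_)
    · exact_mod_cast sub_pos.2 hg1
    · exact_mod_cast hg0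
  have hdiag : ∀ j i, H j i i = if i = j then 0 else 1 / ((k : ℂ) - 1) := by
    intro j i
    by_cases hij : i = j
    · simp [hH, hu, vecMulVec_apply, hij]
    · simp [hH, hu, vecMulVec_apply, hij, ha]
  refine antidistinguishable_of_gram (by omega) hG.symm hGpos.isUnit (H := H) ?_ ?_ ?_ ?_
  · intro j
    refine ((PosSemidef.diagonal fun i => ?_).smul ?_).add
      ((posSemidef_vecMulVec_self_star _).smul ?_)
    · simp only [hu, Pi.zero_apply]
      split_ifs <;> simp
    · exact_mod_cast ha0
    · exact_mod_cast hb0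
  · ext i l
    rw [Matrix.sum_apply, hGa]
    have hcard : ∀ s : Finset (Fin k),
        ∑ j, (if j ∈ s then (0 : ℂ) else 1) = (k : ℂ) - s.card := by
      intro s
      have h : ∀ j, (if j ∈ s then (0 : ℂ) else 1) = 1 - if j ∈ s then 1 else 0 := by
        intro j
        split_ifs <;> simp
      simp [h]
    split_ifs with hil
    · subst hil
      have h : ∀ j, H j i i = (if j ∈ ({i} : Finset (Fin k)) then 0 else 1) *
          (1 / ((k : ℂ) - 1)) := by
        intro j
        rw [hdiag]
        simp only [Finset.mem_singleton, eq_comm (a := j)]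
        split_ifs <;> simp
      simp only [h]
      rw [← Finset.sum_mul, hcard, Finset.card_singleton, Nat.cast_one]
      field_simp
    · have h : ∀ j, H j i l = (if j ∈ ({i, l} : Finset (Fin k)) then 0 else 1) * (b : ℂ) := by
        intro j
        by_cases h1 : i = j <;> by_cases h2 : l = j <;>
          simp [hH, hu, vecMulVec_apply, hil, h1, h2, Ne.symm]
      simp only [h]
      rw [← Finset.sum_mul, hcard, Finset.card_pair hil, hb]
      push_cast
      field_simp
  · intro j
    simp [hdiag]
  · intro j
    have : Nontrivial (Fin k) := Fin.nontrivial_iff_two_le.2 (by omega)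
    obtain ⟨i, hi⟩ := exists_ne j
    refine ⟨i, ?_⟩
    rw [hdiag, if_neg hi]
    exact one_div_ne_zero hk1

/-- For `k ≥ 3` unit vectors with equal real inner products `γ ∈ ((k-2)/(k-1), 1)`, the
family is `N`-copy antidistinguishable for `N = ⌈ln((k-2)/(k-1)) / ln γ⌉`. -/
theorem stmt12 {d k : ℕ} (hk : 3 ≤ k) (ψ : Fin k → Fin d → ℂ)
    (hunit : ∀ i, inp (ψ i) (ψ i) = 1)
    (γ : ℝ) (hγl : ((k : ℝ) - 2) / ((k : ℝ) - 1) < γ) (hγu : γ < 1)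
    (hinner : ∀ i j, i ≠ j → inp (ψ i) (ψ j) = (γ : ℂ)) :
    NCopyAntidistinguishable ψ
      ⌈Real.log (((k : ℝ) - 2) / ((k : ℝ) - 1)) / Real.log γ⌉₊ := by
  have hk' : (3 : ℝ) ≤ k := by exact_mod_cast hk
  have hr0 : 0 < ((k : ℝ) - 2) / ((k : ℝ) - 1) := div_pos (by linarith) (by linarith)
  have hγ0 : 0 < γ := hr0.trans hγl
  have hlog : Real.log γ < 0 := Real.log_neg hγ0 hγu
  have hu : ∀ N i, inp (tpow (ψ i) N) (tpow (ψ i) N) = 1 := by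
    intro N i
    rw [inp_tpow, hunit, one_pow]
  have hi : ∀ N i j, i ≠ j → inp (tpow (ψ i) N) (tpow (ψ j) N) = ((γ ^ N : ℝ) : ℂ) := by
    intro N i j hij
    rw [inp_tpow, hinner i j hij, Complex.ofReal_pow]
  have hpow : ∀ N : ℕ, γ ^ N ≤ ((k : ℝ) - 2) / ((k : ℝ) - 1) ↔
      ⌈Real.log (((k : ℝ) - 2) / ((k : ℝ) - 1)) / Real.log γ⌉₊ ≤ N := by
    intro N
    rw [Nat.ceil_le, div_le_iff_of_neg hlog, ← Real.log_pow,
      Real.log_le_log_iff (pow_pos hγ0 N) hr0]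
  refine ⟨antidistinguishable_of_inner_le hk (hu _) (hi _) (pow_pos hγ0 _).le
    ((hpow _).2 le_rfl), fun N' _ hN' h => ?_⟩
  exact hN'.not_ge ((hpow N').1 (h.inner_le hk (hu N') (hi N')))

end

end QSE
end
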